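/- Every finite-dimensional simple module over the group algebra 𝔽₃[A₄] of the alternating group A₄ on 4 letters over the field 𝔽₃ is either 1-dimensional over 𝔽₃ with trivial A₄-action, or 3-dimensional over 𝔽₃; moreover, any two 3-dimensional simple 𝔽₃[A₄]-modules are isomorphic as 𝔽₃[A₄]-modules. -/

import Mathlib

namespace AlternatingFour

/-- The group algebra `𝔽₃[A₄]`. -/
abbrev GroupAlg : Type := MonoidAlgebra (ZMod 3) (alternatingGroup (Fin 4))

/-- The double transposition `(0 1)(2 3)`. -/
def a : alternatingGroup (Fin 4) := ⟨Equiv.swap 0 1 * Equiv.swap 2 3,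
  Equiv.Perm.mem_alternatingGroup.2 (by decide)⟩

/-- The double transposition `(0 2)(1 3)`. -/
def b : alternatingGroup (Fin 4) := ⟨Equiv.swap 0 2 * Equiv.swap 1 3,
  Equiv.Perm.mem_alternatingGroup.2 (by decide)⟩

/-- The `3`-cycle `(1 2 3)`, which conjugates `a` to `b` and `b` to `a * b`. -/
def t : alternatingGroup (Fin 4) := ⟨Equiv.swap 1 2 * Equiv.swap 2 3,
  Equiv.Perm.mem_alternatingGroup.2 (by decide)⟩

lemma a_mul_a : a * a = 1 := by decide

lemma b_mul_b : b * b = 1 := by decide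

lemma b_mul_a : b * a = a * b := by decide

lemma t_mul_t_mul_t : t * (t * t) = 1 := by decide

lemma b_mul_t : b * t = t * a := by decide

lemma a_mul_t : a * t = t * (a * b) := by decide

lemma exists_eq_mul (g : alternatingGroup (Fin 4)) :
    ∃ (i : Fin 3) (j k : Fin 2), g = t ^ (i : ℕ) * (a ^ (j : ℕ) * b ^ (k : ℕ)) := by
  revert g
  decide

/-- The inclusion of the group `A₄` into its group algebra. -/
local notation "ρ" => MonoidAlgebra.of (ZMod 3) (alternatingGroup (Fin 4))

section Module

variable {M : Type} [AddCommGroup M] [Module GroupAlg M]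

lemma a_smul_a_smul (m : M) : ρ a • ρ a • m = m := by
  rw [← mul_smul, ← map_mul, a_mul_a, map_one, one_smul]

lemma b_smul_b_smul (m : M) : ρ b • ρ b • m = m := by
  rw [← mul_smul, ← map_mul, b_mul_b, map_one, one_smul]

lemma b_smul_a_smul (m : M) : ρ b • ρ a • m = ρ a • ρ b • m := by
  simp only [← mul_smul, ← map_mul, b_mul_a]

lemma t_smul_t_smul_t_smul (m : M) : ρ t • ρ t • ρ t • m = m := by
  rw [← mul_smul, ← mul_smul, ← map_mul, ← map_mul, mul_assoc, t_mul_t_mul_t, map_one, one_smul]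

lemma b_smul_t_smul (m : M) : ρ b • ρ t • m = ρ t • ρ a • m := by
  simp only [← mul_smul, ← map_mul, b_mul_t]

lemma a_smul_t_smul (m : M) : ρ a • ρ t • m = ρ t • ρ a • ρ b • m := by
  simp only [← mul_smul, ← map_mul, a_mul_t]

lemma of_smul_eq_self {m : M} (ha : ρ a • m = m) (hb : ρ b • m = m) (ht : ρ t • m = m)
    (g : alternatingGroup (Fin 4)) : ρ g • m = m := by
  obtain ⟨i, j, k, rfl⟩ := exists_eq_mul g
  fin_cases i <;> fin_cases j <;> fin_cases k <;>
    simp only [pow_zero, pow_one, pow_two, map_mul, map_one, mul_smul, one_smul, ha, hb, ht]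

lemma three_nsmul_eq_zero (m : M) : (3 : ℕ) • m = 0 := by
  have h : ((3 : ℕ) : GroupAlg) = 0 := by
    rw [← map_natCast (algebraMap (ZMod 3) GroupAlg), CharP.cast_eq_zero, map_zero]
  rw [← Nat.cast_smul_eq_nsmul GroupAlg, h, zero_smul]

lemma eq_zero_of_add_self_eq_zero {m : M} (h : m + m = 0) : m = 0 := by
  have h3 := three_nsmul_eq_zero m
  rw [succ_nsmul, two_nsmul, h, zero_add] at h3
  exact h3

/-- If `⟨a, b⟩` has no nonzero vector on which `a` acts as `1` and `b` acts as `-1`,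
then it acts trivially. -/
lemma a_smul_eq_and_b_smul_eq (h : ∀ v : M, ρ a • v = v → ρ b • v = -v → v = 0) (m : M) :
    ρ a • m = m ∧ ρ b • m = m := by
  have key (n : M) : n + ρ a • n - ρ b • n - ρ a • ρ b • n = 0 := by
    apply h <;> simp only [smul_add, smul_sub, a_smul_a_smul, b_smul_b_smul, b_smul_a_smul] <;>
      abel
  have h₁ := key m
  have h₂ := congr_arg (ρ t • ·) (key (ρ t • ρ t • m))
  have h₃ := congr_arg (ρ t • ρ t • ·) (key (ρ t • m))
  simp only [smul_add, smul_sub, smul_zero, a_smul_t_smul, b_smul_t_smul, a_smul_a_smul,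
    b_smul_b_smul, b_smul_a_smul, t_smul_t_smul_t_smul] at h₂ h₃
  refine ⟨(sub_eq_zero.1 (eq_zero_of_add_self_eq_zero ?_)).symm,
    (sub_eq_zero.1 (eq_zero_of_add_self_eq_zero ?_)).symm⟩
  · linear_combination (norm := abel) h₂ + h₃
  · linear_combination (norm := abel) h₁ + h₃

/-- Since `(t - 1) ^ 3 = 0`, `t` fixes a nonzero vector of every nonzero module. -/
lemma exists_t_smul_eq [Nontrivial M] : ∃ v : M, v ≠ 0 ∧ ρ t • v = v := by
  obtain ⟨m, hm⟩ := exists_ne (0 : M)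
  by_contra! h
  have h' (v : M) (hv : ρ t • v - v = 0) : v = 0 := by
    by_contra hv0
    exact h v hv0 (sub_eq_zero.1 hv)
  refine hm (h' _ (h' _ (h' _ ?_)))
  have h3 := three_nsmul_eq_zero (ρ t • m - ρ t • ρ t • m)
  simp only [smul_sub, t_smul_t_smul_t_smul] at h3 ⊢
  rw [← h3]
  abel

end Module

/-- Every element of `𝔽₃[A₄]` acts on vectors fixed by `a` and negated by `b` as a
combination of `1`, `t` and `t ^ 2`. -/
lemma exists_smul_eq (r : GroupAlg) : ∃ x y z : ZMod 3, ∀ (M : Type) [AddCommGroup M]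
    [Module GroupAlg M] [Module (ZMod 3) M] [IsScalarTower (ZMod 3) GroupAlg M] (v : M),
    ρ a • v = v → ρ b • v = -v → r • v = x • v + y • ρ t • v + z • ρ t • ρ t • v := by
  induction r using MonoidAlgebra.induction_on with
  | of g =>
    obtain ⟨i, j, k, rfl⟩ := exists_eq_mul g
    refine ⟨if i = 0 then (-1) ^ (k : ℕ) else 0, if i = 1 then (-1) ^ (k : ℕ) else 0,
      if i = 2 then (-1) ^ (k : ℕ) else 0, fun M _ _ _ _ v ha hb => ?_⟩
    fin_cases i <;> fin_cases j <;> fin_cases k <;>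
      simp [-MonoidAlgebra.of_apply, pow_two, mul_smul, ha, hb]
  | add r s hr hs =>
    obtain ⟨x, y, z, hr⟩ := hr
    obtain ⟨x', y', z', hs⟩ := hs
    refine ⟨x + x', y + y', z + z', fun M _ _ _ _ v ha hb => ?_⟩
    rw [add_smul, hr M v ha hb, hs M v ha hb]
    simp only [add_smul]
    abel
  | smul c r hr =>
    obtain ⟨x, y, z, hr⟩ := hr
    refine ⟨c * x, c * y, c * z, fun M _ _ _ _ v ha hb => ?_⟩
    simp only [smul_assoc, hr M v ha hb, smul_add, mul_smul]

section Scalars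

variable {M : Type} [AddCommGroup M] [Module GroupAlg M] [Module (ZMod 3) M]
  [IsScalarTower (ZMod 3) GroupAlg M]

lemma coeff_eq_zero {v : M} (hv : v ≠ 0) (ha : ρ a • v = v) (hb : ρ b • v = -v)
    {x y z : ZMod 3} (h : x • v + y • ρ t • v + z • ρ t • ρ t • v = 0) :
    x = 0 ∧ y = 0 ∧ z = 0 := by
  have hA := congr_arg (ρ a • ·) h
  have hB := congr_arg (ρ b • ·) h
  simp only [smul_add, smul_zero, smul_comm (ρ _) (_ : ZMod 3), a_smul_t_smul, b_smul_t_smul,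
    ha, hb, smul_neg] at hA hB
  have ht : ρ t • v ≠ 0 := fun h0 => hv (by
    rw [← t_smul_t_smul_t_smul v, h0, smul_zero, smul_zero])
  have htt : ρ t • ρ t • v ≠ 0 := fun h0 => hv (by
    rw [← t_smul_t_smul_t_smul v, h0, smul_zero])
  refine ⟨(smul_eq_zero_iff_left hv).1 (eq_zero_of_add_self_eq_zero ?_),
    (smul_eq_zero_iff_left ht).1 (eq_zero_of_add_self_eq_zero ?_),
    (smul_eq_zero_iff_left htt).1 (eq_zero_of_add_self_eq_zero ?_)⟩
  · linear_combination (norm := abel) h + hA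
  · linear_combination (norm := abel) h + hB
  · linear_combination (norm := abel) -hA - hB

lemma finrank_eq_three [IsSimpleModule GroupAlg M] {v : M} (hv : v ≠ 0) (ha : ρ a • v = v)
    (hb : ρ b • v = -v) : Module.finrank (ZMod 3) M = 3 := by
  have hli : LinearIndependent (ZMod 3) ![v, ρ t • v, ρ t • ρ t • v] := by
    rw [Fintype.linearIndependent_iff]
    intro g hg
    simp only [Fin.sum_univ_three, Matrix.cons_val] at hg
    obtain ⟨h₀, h₁, h₂⟩ := coeff_eq_zero hv ha hb hg
    intro i
    fin_cases i <;> assumption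
  have hspan : ⊤ ≤ Submodule.span (ZMod 3) (Set.range ![v, ρ t • v, ρ t • ρ t • v]) := by
    intro m _
    obtain ⟨r, rfl⟩ := IsSimpleModule.toSpanSingleton_surjective GroupAlg hv m
    obtain ⟨x, y, z, h⟩ := exists_smul_eq r
    rw [LinearMap.toSpanSingleton_apply, h M v ha hb]
    refine add_mem (add_mem ?_ ?_) ?_ <;> refine Submodule.smul_mem _ _ (Submodule.subset_span ?_)
    exacts [⟨0, rfl⟩, ⟨1, rfl⟩, ⟨2, rfl⟩]
  rw [Module.finrank_eq_card_basis (Module.Basis.mk hli hspan), Fintype.card_fin]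

lemma exists_smul_eq_of_fixed {v : M} (h : ∀ g, ρ g • v = v) (r : GroupAlg) :
    ∃ x : ZMod 3, x • v = r • v := by
  induction r using MonoidAlgebra.induction_on with
  | of g => exact ⟨1, by rw [one_smul, h]⟩
  | add r s hr hs =>
    obtain ⟨x, hx⟩ := hr
    obtain ⟨y, hy⟩ := hs
    exact ⟨x + y, by rw [add_smul, add_smul, hx, hy]⟩
  | smul c r hr =>
    obtain ⟨x, hx⟩ := hr
    exact ⟨c * x, by rw [mul_smul, hx, smul_assoc]⟩

lemma exists_ne_zero_or_trivial [IsSimpleModule GroupAlg M] :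
    (∃ v : M, v ≠ 0 ∧ ρ a • v = v ∧ ρ b • v = -v) ∨
      (Module.finrank (ZMod 3) M = 1 ∧ ∀ g (m : M), ρ g • m = m) := by
  refine or_iff_not_imp_left.2 fun h => ?_
  have htriv := a_smul_eq_and_b_smul_eq (M := M) fun v ha hb => by
    by_contra hv
    exact h ⟨v, hv, ha, hb⟩
  have := IsSimpleModule.nontrivial GroupAlg M
  obtain ⟨v, hv, ht⟩ := exists_t_smul_eq (M := M)
  have hfix := of_smul_eq_self (htriv v).1 (htriv v).2 ht
  have hspan (m : M) : ∃ x : ZMod 3, x • v = m := by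
    obtain ⟨r, rfl⟩ := IsSimpleModule.toSpanSingleton_surjective GroupAlg hv m
    exact exists_smul_eq_of_fixed hfix r
  refine ⟨finrank_eq_one v hv hspan, fun g m => ?_⟩
  obtain ⟨x, rfl⟩ := hspan m
  rw [smul_comm, hfix]

lemma exists_ne_zero_of_finrank_eq_three [IsSimpleModule GroupAlg M]
    (h : Module.finrank (ZMod 3) M = 3) : ∃ v : M, v ≠ 0 ∧ ρ a • v = v ∧ ρ b • v = -v :=
  exists_ne_zero_or_trivial.resolve_right fun h' => by simp [h] at h'

variable {N : Type} [AddCommGroup N] [Module GroupAlg N] [Module (ZMod 3) N]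
  [IsScalarTower (ZMod 3) GroupAlg N]

lemma ker_toSpanSingleton_le {v : M} (hv : v ≠ 0) (hva : ρ a • v = v) (hvb : ρ b • v = -v)
    {w : N} (hwa : ρ a • w = w) (hwb : ρ b • w = -w) :
    LinearMap.ker (LinearMap.toSpanSingleton GroupAlg M v) ≤
      LinearMap.ker (LinearMap.toSpanSingleton GroupAlg N w) := by
  intro r hr
  rw [LinearMap.mem_ker, LinearMap.toSpanSingleton_apply] at hr ⊢
  obtain ⟨x, y, z, h⟩ := exists_smul_eq r
  rw [h M v hva hvb] at hr
  obtain ⟨rfl, rfl, rfl⟩ := coeff_eq_zero hv hva hvb hr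
  simp only [h N w hwa hwb, zero_smul, add_zero]

lemma nonempty_linearEquiv [IsSimpleModule GroupAlg M] [IsSimpleModule GroupAlg N]
    {v : M} (hv : v ≠ 0) (hva : ρ a • v = v) (hvb : ρ b • v = -v)
    {w : N} (hw : w ≠ 0) (hwa : ρ a • w = w) (hwb : ρ b • w = -w) :
    Nonempty (M ≃ₗ[GroupAlg] N) :=
  ⟨((LinearMap.toSpanSingleton GroupAlg M v).quotKerEquivOfSurjective
      (IsSimpleModule.toSpanSingleton_surjective GroupAlg hv)).symm.trans
    ((Submodule.quotEquivOfEq _ _ (le_antisymm (ker_toSpanSingleton_le hv hva hvb hwa hwb)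
      (ker_toSpanSingleton_le hw hwa hwb hva hvb))).trans
    ((LinearMap.toSpanSingleton GroupAlg N w).quotKerEquivOfSurjective
      (IsSimpleModule.toSpanSingleton_surjective GroupAlg hw)))⟩

end Scalars

end AlternatingFour

/-- Every finite-dimensional simple module over the group algebra
`𝔽₃[A₄]` is either `1`-dimensional over `𝔽₃` with trivial `A₄`-action, or `3`-dimensional;
moreover any two `3`-dimensional simple `𝔽₃[A₄]`-modules are isomorphic. -/
theorem simple_F3A4_modules_classification :
    (∀ (M : Type) [AddCommGroup M]
        [Module (MonoidAlgebra (ZMod 3) (alternatingGroup (Fin 4))) M]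
        [Module (ZMod 3) M]
        [IsScalarTower (ZMod 3) (MonoidAlgebra (ZMod 3) (alternatingGroup (Fin 4))) M],
      IsSimpleModule (MonoidAlgebra (ZMod 3) (alternatingGroup (Fin 4))) M →
      FiniteDimensional (ZMod 3) M →
      (Module.finrank (ZMod 3) M = 1 ∧
        ∀ (g : alternatingGroup (Fin 4)) (m : M),
          (MonoidAlgebra.of (ZMod 3) (alternatingGroup (Fin 4)) g) • m = m) ∨
      Module.finrank (ZMod 3) M = 3) ∧
    (∀ (M N : Type) [AddCommGroup M] [AddCommGroup N]
        [Module (MonoidAlgebra (ZMod 3) (alternatingGroup (Fin 4))) M]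
        [Module (MonoidAlgebra (ZMod 3) (alternatingGroup (Fin 4))) N]
        [Module (ZMod 3) M] [Module (ZMod 3) N]
        [IsScalarTower (ZMod 3) (MonoidAlgebra (ZMod 3) (alternatingGroup (Fin 4))) M]
        [IsScalarTower (ZMod 3) (MonoidAlgebra (ZMod 3) (alternatingGroup (Fin 4))) N],
      IsSimpleModule (MonoidAlgebra (ZMod 3) (alternatingGroup (Fin 4))) M →
      IsSimpleModule (MonoidAlgebra (ZMod 3) (alternatingGroup (Fin 4))) N →
      Module.finrank (ZMod 3) M = 3 → Module.finrank (ZMod 3) N = 3 →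
      Nonempty (M ≃ₗ[MonoidAlgebra (ZMod 3) (alternatingGroup (Fin 4))] N)) := by
  refine ⟨fun M _ _ _ _ _ _ => ?_, fun M N _ _ _ _ _ _ _ _ _ _ hM hN => ?_⟩
  · obtain ⟨v, hv, ha, hb⟩ | h := AlternatingFour.exists_ne_zero_or_trivial (M := M)
    · exact Or.inr (AlternatingFour.finrank_eq_three hv ha hb)
    · exact Or.inl h
  · obtain ⟨v, hv, hva, hvb⟩ := AlternatingFour.exists_ne_zero_of_finrank_eq_three hM
    obtain ⟨w, hw, hwa, hwb⟩ := AlternatingFour.exists_ne_zero_of_finrank_eq_three hN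
    exact AlternatingFour.nonempty_linearEquiv hv hva hvb hw hwa hwb
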